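/- (Cubic bound on the remainder.) There exists C > 0, depending only on N, σ, e and Z, such that for all α ∈ ℝ, r ∈ ℝ³, every N·ℤ³-periodic C¹ function φ : ℝ³ → ℂ and every κ : Γ_N → ℝ³ with ‖Y‖ := (∫_{T_N}(|φ|²+|∇φ|²)dx)^{1/2} + (∑_{n∈Γ_N}|κ(n)|²)^{1/2} ≤ 1, one has |½·(2ρ^{(1)}+ρ^{(2)}, Gρ^{(2)})| ≤ C·‖Y‖³, where ρ^{(1)}(x) := −∑_{n∈Γ_N} κ(n)·∇σ(x−n−r) − 2e√Z·Re(e^{−iα}φ(x)), ρ^{(2)}(x) := ∑_{n∈Γ_N}[σ(x−n−r−κ(n)) − σ(x−n−r) + κ(n)·∇σ(x−n−r)] − e|φ(x)|², and (f,Gg) := N^{−3} ∑_{ξ∈Γ*_N\{0}} Re( f̂(ξ)·conj(ĝ(ξ)) )/|ξ|². -/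

import Mathlib

noncomputable section

namespace SPN

open MeasureTheory Finset
open scoped Real

/-- Points of `ℝ³`. -/
abbrev V3 : Type := Fin 3 → ℝ

/-- Euclidean dot product on `ℝ³`. -/
def dotP (v w : V3) : ℝ := ∑ i, v i * w i

/-- Squared Euclidean norm on `ℝ³`. -/
def nsqV (v : V3) : ℝ := ∑ i, v i ^ 2

/-- The fundamental cube `[0,N)³` of the torus `T_N = ℝ³/(N·ℤ³)`. -/
def cubeN (N : ℕ) : Set V3 := {x | ∀ i, x i ∈ Set.Ico (0 : ℝ) (N : ℝ)}

/-- `N·ℤ³`-periodicity of a function on `ℝ³`. -/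
def IsPerN {α : Type*} (N : ℕ) (f : V3 → α) : Prop :=
  ∀ (x : V3) (k : Fin 3 → ℤ), f (x + fun i => (N : ℝ) * (k i : ℝ)) = f x

/-- Index set for `Γ_N = {0,…,N−1}³`. -/
abbrev GammaIdx (N : ℕ) : Type := Fin 3 → Fin N

/-- The lattice point of `Γ_N` associated to an index. -/
def embG {N : ℕ} (n : GammaIdx N) : V3 := fun i => ((n i : ℕ) : ℝ)

/-- Fourier coefficient `f̂(ξ) = ∫_{T_N} e^{iξ·x} f(x) dx`. -/
def fCoeff (N : ℕ) (f : V3 → ℂ) (ξ : V3) : ℂ :=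
  ∫ x in cubeN N, Complex.exp (Complex.I * ((dotP ξ x : ℝ) : ℂ)) * f x

/-- Fourier coefficient of a real-valued function. -/
def fCoeffR (N : ℕ) (f : V3 → ℝ) (ξ : V3) : ℂ :=
  fCoeff N (fun x => ((f x : ℝ) : ℂ)) ξ

/-- The point `(2π/N)·k` of the dual lattice `Γ*_N`. -/
def xiN (N : ℕ) (k : Fin 3 → ℤ) : V3 := fun i => (2 * π / (N : ℝ)) * (k i : ℝ)

/-- The Jellium condition: `σ̂(ξ) = 0` for all `ξ ∈ Γ*_1 \ {0}`. -/
def JelliumCond (N : ℕ) (σ : V3 → ℝ) : Prop :=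
  ∀ k : Fin 3 → ℤ, k ≠ 0 → fCoeffR N σ (fun i => 2 * π * (k i : ℝ)) = 0

/-- `(2π/N)·k ∈ Γ*_1`, i.e. every coordinate of `k` is divisible by `N`. -/
def inGamma1 (N : ℕ) (k : Fin 3 → ℤ) : Prop := ∀ i, (N : ℤ) ∣ k i

/-- `|∇φ(x)|²` for a complex-valued function. -/
def gradSq (φ : V3 → ℂ) (x : V3) : ℝ :=
  ∑ i, Complex.normSq (fderiv ℝ φ x (Pi.single i 1))

/-- Gradient of a real-valued function on `ℝ³`. -/
def gradV (f : V3 → ℝ) (x : V3) : V3 := fun i => fderiv ℝ f x (Pi.single i 1)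

/-- Total charge density `ρ(x) = ∑_n σ(x−n−q(n)) − e|ψ(x)|²`. -/
def rhoT (N : ℕ) (σ : V3 → ℝ) (e : ℝ) (ψ : V3 → ℂ) (q : GammaIdx N → V3) (x : V3) : ℝ :=
  (∑ n : GammaIdx N, σ (x - embG n - q n)) - e * Complex.normSq (ψ x)

/-- `∑_{ξ∈Γ*_N\{0}} |f̂(ξ)|²/|ξ|²`. -/
def dualSum (N : ℕ) (f : V3 → ℝ) : ℝ :=
  ∑' k : Fin 3 → ℤ, if k = 0 then 0 else
    Complex.normSq (fCoeffR N f (xiN N k)) / nsqV (xiN N k)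

/-- The energy functional `E(ψ,q,p)`. -/
def energyE (N : ℕ) (σ : V3 → ℝ) (e M : ℝ) (ψ : V3 → ℂ) (q p : GammaIdx N → V3) : ℝ :=
  (1 / 2) * (∫ x in cubeN N, gradSq ψ x)
    + (2 * (N : ℝ) ^ 3)⁻¹ * dualSum N (rhoT N σ e ψ q)
    + (2 * M)⁻¹ * ∑ n : GammaIdx N, nsqV (p n)

/-- The matrix `Σ(θ) = ∑_{m∈ℤ³} (ξξᵀ/|ξ|²)|σ̂(ξ)|²`, `ξ = θ + 2πm`. -/
def SigMat (N : ℕ) (σ : V3 → ℝ) (θ : V3) : Matrix (Fin 3) (Fin 3) ℝ :=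
  Matrix.of fun a b => ∑' m : Fin 3 → ℤ,
    ((θ a + 2 * π * (m a : ℝ)) * (θ b + 2 * π * (m b : ℝ))
        / nsqV (fun i => θ i + 2 * π * (m i : ℝ)))
      * Complex.normSq (fCoeffR N σ (fun i => θ i + 2 * π * (m i : ℝ)))

/-- The Wiener condition: `Σ(θ)` is positive definite for all `θ ∈ Γ*_N \ Γ*_1`. -/
def WienerCond (N : ℕ) (σ : V3 → ℝ) : Prop :=
  ∀ k : Fin 3 → ℤ, ¬ inGamma1 N k → (SigMat N σ (xiN N k)).PosDef

/-- First-order ionic density `σ⁽¹⁾(x) = −∑_n κ(n)·∇σ(x−n−r)`. -/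
def sigma1F (N : ℕ) (σ : V3 → ℝ) (r : V3) (κ : GammaIdx N → V3) (x : V3) : ℝ :=
  - ∑ n : GammaIdx N, dotP (κ n) (gradV σ (x - embG n - r))

/-- First-order charge density `ρ⁽¹⁾(x) = σ⁽¹⁾(x) − 2e√Z·Re(e^{−iα}φ(x))`. -/
def rho1F (N : ℕ) (σ : V3 → ℝ) (e Z α : ℝ) (r : V3) (κ : GammaIdx N → V3)
    (φ : V3 → ℂ) (x : V3) : ℝ :=
  sigma1F N σ r κ x - 2 * e * Real.sqrt Z * (Complex.exp (-Complex.I * (α : ℂ)) * φ x).re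

/-- The quadratic form `B(φ,κ,p)` (half of the energy Hessian). -/
def BformQ (N : ℕ) (σ : V3 → ℝ) (e Z M α : ℝ) (r : V3)
    (φ : V3 → ℂ) (κ p : GammaIdx N → V3) : ℝ :=
  (1 / 2) * (∫ x in cubeN N, gradSq φ x)
    + (2 * (N : ℝ) ^ 3)⁻¹ * dualSum N (rho1F N σ e Z α r κ φ)
    + (2 * M)⁻¹ * ∑ n : GammaIdx N, nsqV (p n)

/-- Second-order charge density `ρ⁽²⁾`. -/
def rho2F (N : ℕ) (σ : V3 → ℝ) (e : ℝ) (r : V3) (κ : GammaIdx N → V3)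
    (φ : V3 → ℂ) (x : V3) : ℝ :=
  (∑ n : GammaIdx N,
      (σ (x - embG n - r - κ n) - σ (x - embG n - r)
        + dotP (κ n) (gradV σ (x - embG n - r))))
    - e * Complex.normSq (φ x)

/-- The pairing `(f, Gg) = N⁻³ ∑_{ξ∈Γ*_N\{0}} Re(f̂(ξ)·conj(ĝ(ξ)))/|ξ|²`. -/
def GPair (N : ℕ) (f g : V3 → ℝ) : ℝ :=
  ((N : ℝ) ^ 3)⁻¹ * ∑' k : Fin 3 → ℤ, if k = 0 then 0 else
    (fCoeffR N f (xiN N k) * (starRingEnd ℂ) (fCoeffR N g (xiN N k))).re / nsqV (xiN N k)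

/-- The distance to the solitary manifold of ground states. -/
def distS (N : ℕ) (Z : ℝ) (ψ : V3 → ℂ) (q p : GammaIdx N → V3) : ℝ :=
  ⨅ (α : ℝ) (r : V3),
    (Real.sqrt (∫ x in cubeN N,
        (Complex.normSq (ψ x - Complex.exp (Complex.I * (α : ℂ)) * ((Real.sqrt Z : ℝ) : ℂ))
          + gradSq ψ x))
      + Real.sqrt (∑ n : GammaIdx N, ⨅ k : Fin 3 → ℤ,
          nsqV (fun i => q n i - r i - (N : ℝ) * (k i : ℝ)))
      + Real.sqrt (∑ n : GammaIdx N, nsqV (p n)))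

/-- The discrete Fourier transform `κ̂(θ) ∈ ℂ³` of `κ : Γ_N → ℝ³`. -/
def hatK (N : ℕ) (κ : GammaIdx N → V3) (θ : V3) (a : Fin 3) : ℂ :=
  ∑ n : GammaIdx N, Complex.exp (Complex.I * ((dotP θ (embG n) : ℝ) : ℂ)) * ((κ n a : ℝ) : ℂ)

/-- Laplacian of a complex-valued function on `ℝ³`. -/
def lapC (f : V3 → ℂ) (x : V3) : ℂ :=
  ∑ i, fderiv ℝ (fun y => fderiv ℝ f y (Pi.single i 1)) x (Pi.single i 1)

/-- Laplacian of a real-valued function on `ℝ³`. -/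
def lapR (f : V3 → ℝ) (x : V3) : ℝ :=
  ∑ i, fderiv ℝ (fun y => fderiv ℝ f y (Pi.single i 1)) x (Pi.single i 1)

/-- A classical solution of the Schrödinger–Poisson–Newton system on `ℝ`. -/
structure IsSPN (N : ℕ) (σ : V3 → ℝ) (e M : ℝ)
    (ψ : V3 → ℝ → ℂ) (Φ : V3 → ℝ → ℝ) (q : ℝ → GammaIdx N → V3) : Prop where
  per_psi : ∀ t : ℝ, IsPerN N (fun x => ψ x t)
  per_Phi : ∀ t : ℝ, IsPerN N (fun x => Φ x t)
  regx_psi : ∀ t : ℝ, ContDiff ℝ 2 (fun x => ψ x t)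
  regt_psi : ∀ x : V3, ContDiff ℝ 1 (fun t => ψ x t)
  regx_Phi : ∀ t : ℝ, ContDiff ℝ 2 (fun x => Φ x t)
  regt_Phi : ∀ x : V3, ContDiff ℝ 1 (fun t => Φ x t)
  reg_q : ContDiff ℝ 2 q
  schrodinger : ∀ (x : V3) (t : ℝ),
    Complex.I * deriv (fun s => ψ x s) t =
      -(1 / 2 : ℂ) * lapC (fun y => ψ y t) x - ((e : ℝ) : ℂ) * ((Φ x t : ℝ) : ℂ) * ψ x t
  poisson : ∀ (x : V3) (t : ℝ),
    - lapR (fun y => Φ y t) x =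
      (∑ n : GammaIdx N, σ (x - embG n - q t n)) - e * Complex.normSq (ψ x t)
  newton : ∀ (n : GammaIdx N) (t : ℝ) (i : Fin 3),
    M * deriv (fun s => deriv (fun u => q u n i) s) t =
      - ∫ x in cubeN N, fderiv ℝ (fun y => Φ y t) x (Pi.single i 1) * σ (x - embG n - q t n)

lemma cubeN_eq_pi (N : ℕ) : cubeN N = Set.pi Set.univ (fun _ : Fin 3 => Set.Ico (0:ℝ) (N:ℝ)) := by
  ext x; simp [cubeN, Set.mem_pi]

lemma measCube (N : ℕ) : MeasurableSet (cubeN N) := by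
  rw [cubeN_eq_pi]; exact MeasurableSet.univ_pi fun _ => measurableSet_Ico

lemma cube_ae (N : ℕ) : cubeN N =ᵐ[volume] Set.Icc (0 : V3) (fun _ => (N:ℝ)) := by
  rw [cubeN_eq_pi, volume_pi]
  exact Measure.univ_pi_Ico_ae_eq_Icc

lemma cube_sub (N : ℕ) : cubeN N ⊆ Set.Icc (0 : V3) (fun _ => (N:ℝ)) :=
  fun _ hx => ⟨fun i => (hx i).1, fun i => (hx i).2.le⟩

lemma intOn {E : Type*} [NormedAddCommGroup E] (N : ℕ) {f : V3 → E} (hf : Continuous f) :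
    IntegrableOn f (cubeN N) :=
  (hf.continuousOn.integrableOn_compact isCompact_Icc).mono_set (cube_sub N)

lemma vol_cube (N : ℕ) : (volume : Measure V3).real (cubeN N) = (N:ℝ)^3 := by
  rw [measureReal_def, cubeN_eq_pi, Real.volume_pi_Ico_toReal]
  · simp
  · intro i; positivity

instance finCube (N : ℕ) : IsFiniteMeasure ((volume : Measure V3).restrict (cubeN N)) := by
  refine ⟨?_⟩
  rw [Measure.restrict_apply_univ]
  exact (measure_mono (cube_sub N)).trans_lt isCompact_Icc.measure_lt_top

lemma int_fderiv_zero (N : ℕ) (F : V3 → ℂ) (hF : ContDiff ℝ 1 F) (hp : IsPerN N F) (i : Fin 3) :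
    ∫ x in cubeN N, fderiv ℝ F x (Pi.single i 1) = 0 := by
  rw [setIntegral_congr_set (cube_ae N)]
  have hc : Continuous (fun x => fderiv ℝ F x) := hF.continuous_fderiv (by norm_num)
  have h := integral_divergence_of_hasFDerivAt_off_countable' (n := 2) (0 : V3) (fun _ => (N:ℝ))
    (fun _ => by simp) (fun j => if j = i then F else 0)
    (fun j => if j = i then fun x => fderiv ℝ F x else 0) ∅ Set.countable_empty ?_ ?_ ?_
  · have h1 : ∀ x : V3, (∑ j, (if j = i then fun x => fderiv ℝ F x else
        (0 : V3 → (V3 →L[ℝ] ℂ))) x (Pi.single j 1)) = fderiv ℝ F x (Pi.single i 1) := by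
      intro x
      rw [Finset.sum_eq_single i]
      · simp
      · intro b _ hb; simp [hb]
      · simp
    simp only [h1] at h
    rw [h]
    apply Finset.sum_eq_zero
    intro j _
    by_cases hj : j = i
    · subst hj
      simp only [if_true]
      rw [sub_eq_zero]
      congr 1
      ext x
      symm
      rw [← hp _ (Pi.single j 1)]
      congr 1
      ext l
      rcases eq_or_ne l j with rfl | hl
      · simp
      · obtain ⟨m, rfl⟩ := Fin.exists_succAbove_eq hl
        simp [hl]
    · simp [hj]
  · intro j
    by_cases hj : j = i
    · simp only [hj, if_true]; exact hF.continuous.continuousOn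
    · simp only [hj, if_false]; exact continuousOn_const
  · intro x _ j
    by_cases hj : j = i
    · simp only [hj, if_true]
      exact (hF.differentiable (by norm_num) x).hasFDerivAt
    · simp only [hj, if_false]; exact hasFDerivAt_const (0:ℂ) x
  · apply ContinuousOn.integrableOn_compact isCompact_Icc
    apply Continuous.continuousOn
    apply continuous_finsetSum
    intro j _
    by_cases hj : j = i
    · simp only [hj, if_true]; fun_prop
    · simp only [hj, if_false]; exact continuous_const

def Ek (N : ℕ) (k : Fin 3 → ℤ) (x : V3) : ℂ :=
  Complex.exp (Complex.I * ((dotP (xiN N k) x : ℝ) : ℂ))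

lemma dotP_contDiff (v : V3) : ContDiff ℝ 1 (fun x => dotP v x) := by
  unfold dotP; fun_prop

lemma Ek_contDiff (N : ℕ) (k : Fin 3 → ℤ) : ContDiff ℝ 1 (Ek N k) := by
  unfold Ek
  have h1 : ContDiff ℝ 1 (fun x => ((dotP (xiN N k) x : ℝ) : ℂ)) :=
    Complex.ofRealCLM.contDiff.comp (dotP_contDiff _)
  fun_prop

lemma Ek_norm (N : ℕ) (k : Fin 3 → ℤ) (x : V3) : ‖Ek N k x‖ = 1 := by
  unfold Ek; rw [mul_comm]; exact Complex.norm_exp_ofReal_mul_I _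

lemma Ek_add (N : ℕ) (k l : Fin 3 → ℤ) (x : V3) : Ek N (k + l) x = Ek N k x * Ek N l x := by
  unfold Ek
  rw [← Complex.exp_add]
  congr 1
  simp only [dotP, xiN, Pi.add_apply]
  push_cast
  rw [← mul_add, ← Finset.sum_add_distrib]
  congr 1
  apply Finset.sum_congr rfl
  intros; ring

lemma Ek_neg (N : ℕ) (k : Fin 3 → ℤ) (x : V3) : Ek N (-k) x = (starRingEnd ℂ) (Ek N k x) := by
  unfold Ek
  rw [← Complex.exp_conj]
  congr 1
  simp only [map_mul, Complex.conj_I, Complex.conj_ofReal]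
  simp [dotP, xiN]

lemma Ek_per (N : ℕ) (hN : 0 < N) (k : Fin 3 → ℤ) : IsPerN N (Ek N k) := by
  intro x m
  unfold Ek
  have hN' : (N:ℝ) ≠ 0 := by positivity
  have : dotP (xiN N k) (x + fun i => (N : ℝ) * (m i : ℝ))
      = dotP (xiN N k) x + ((∑ i, k i * m i : ℤ) : ℝ) * (2 * π) := by
    simp only [dotP, xiN, Pi.add_apply, Fin.sum_univ_three]
    push_cast
    field_simp
    ring
  rw [this]
  push_cast
  rw [mul_add, Complex.exp_add]
  have := Complex.exp_int_mul_two_pi_mul_I (∑ i, k i * m i : ℤ)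
  rw [show Complex.I * ((∑ i, (k i:ℂ) * (m i:ℂ)) * (2 * (π:ℂ)))
    = ((∑ i, k i * m i : ℤ) : ℂ) * (2 * π * Complex.I) by push_cast; ring, this, mul_one]

lemma Ek_fderiv (N : ℕ) (k : Fin 3 → ℤ) (x : V3) (i : Fin 3) :
    fderiv ℝ (Ek N k) x (Pi.single i 1) = Complex.I * ((xiN N k i : ℝ) : ℂ) * Ek N k x := by
  have h0 : HasFDerivAt (fun x : V3 => dotP (xiN N k) x)
      (∑ j, (xiN N k j) • (ContinuousLinearMap.proj j : V3 →L[ℝ] ℝ)) x := by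
    unfold dotP
    apply HasFDerivAt.fun_sum
    intro j _
    exact ((ContinuousLinearMap.proj j : V3 →L[ℝ] ℝ).hasFDerivAt).const_mul _
  have h1 := ((Complex.ofRealCLM.hasFDerivAt.comp x h0).const_mul Complex.I).cexp
  have : fderiv ℝ (Ek N k) x = _ := HasFDerivAt.fderiv h1
  rw [this]
  simp [Ek, Pi.single_apply]
  ring

lemma ibp (N : ℕ) (hN : 0 < N) (h : V3 → ℂ) (hh : ContDiff ℝ 1 h) (hp : IsPerN N h)
    (k : Fin 3 → ℤ) (i : Fin 3) :
    Complex.I * ((xiN N k i : ℝ) : ℂ) * fCoeff N h (xiN N k) =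
      - ∫ x in cubeN N, Ek N k x * fderiv ℝ h x (Pi.single i 1) := by
  have hE := Ek_contDiff N k
  have h0 := int_fderiv_zero N (fun x => Ek N k x * h x) (hE.mul hh)
    (fun x m => by simp only [Ek_per N hN k x m, hp x m]) i
  have h1 : ∀ x, fderiv ℝ (fun x => Ek N k x * h x) x (Pi.single i 1)
      = Ek N k x * fderiv ℝ h x (Pi.single i 1)
        + Complex.I * ((xiN N k i : ℝ) : ℂ) * (Ek N k x * h x) := by
    intro x
    rw [fderiv_fun_mul (hE.differentiable (by norm_num) x) (hh.differentiable (by norm_num) x)]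
    simp only [add_apply, smul_apply, Ek_fderiv, smul_eq_mul]
    ring
  simp only [h1] at h0
  have hc : Continuous (fun x => fderiv ℝ h x) := hh.continuous_fderiv (by norm_num)
  have hEc := hE.continuous
  have hhc := hh.continuous
  rw [integral_add (intOn N (by fun_prop)) (intOn N (by fun_prop)), integral_const_mul] at h0
  have : fCoeff N h (xiN N k) = ∫ x in cubeN N, Ek N k x * h x := rfl
  rw [this]
  linear_combination h0

lemma Ek_int (N : ℕ) (hN : 0 < N) (k : Fin 3 → ℤ) :
    ∫ x in cubeN N, Ek N k x = if k = 0 then ((N:ℂ)^3) else 0 := by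
  split_ifs with hk
  · subst hk
    have : ∀ x, Ek N 0 x = 1 := by intro x; simp [Ek, dotP, xiN]
    simp only [this, setIntegral_const, vol_cube]
    simp
  · obtain ⟨i, hi⟩ := Function.ne_iff.1 hk
    have := ibp N hN (fun _ => 1) contDiff_const (fun _ _ => rfl) k i
    simp only [fCoeff, mul_one] at this
    simp at this
    rcases this with h | h
    · exfalso
      simp [xiN] at h
      rcases h with h | h
      · omega
      · exact hi h
    · exact h
lemma bessel (N : ℕ) (hN : 0 < N) (a : V3 → ℂ) (ha : Continuous a) (F : Finset (Fin 3 → ℤ)) :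
    ∑ k ∈ F, ‖fCoeff N a (xiN N k)‖ ^ 2 ≤ (N:ℝ)^3 * ∫ x in cubeN N, ‖a x‖ ^ 2 := by
  set μ := (volume : Measure V3).restrict (cubeN N) with hμ
  have hmem : ∀ f : V3 → ℂ, Continuous f → MemLp f 2 μ := by
    intro f hf
    rw [memLp_two_iff_integrable_sq_norm hf.aestronglyMeasurable]
    exact intOn N (by fun_prop)
  have hinner : ∀ (f g : V3 → ℂ) (hf : Continuous f) (hg : Continuous g),
      inner ℂ ((hmem f hf).toLp f) ((hmem g hg).toLp g)
        = ∫ x, (starRingEnd ℂ) (f x) * g x ∂μ := by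
    intro f g hf hg
    rw [L2.inner_def]
    apply integral_congr_ae
    filter_upwards [(hmem f hf).coeFn_toLp, (hmem g hg).coeFn_toLp] with x h1 h2
    rw [h1, h2]
    simp [mul_comm]
  have hNp : (0:ℝ) < (N:ℝ)^3 := by positivity
  set s : ℝ := (Real.sqrt ((N:ℝ)^3))⁻¹ with hs
  have hs2 : s * s = ((N:ℝ)^3)⁻¹ := by
    rw [hs, ← mul_inv, Real.mul_self_sqrt hNp.le]
  have hEc : ∀ k, Continuous (fun x => (s:ℂ) * Ek N (-k) x) := fun k =>
    continuous_const.mul (Ek_contDiff N _).continuous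
  have horth : Orthonormal ℂ (fun k : Fin 3 → ℤ => (hmem _ (hEc k)).toLp _) := by
    rw [orthonormal_iff_ite]
    intro k l
    rw [hinner _ _ (hEc k) (hEc l)]
    have : ∀ x, (starRingEnd ℂ) ((s:ℂ) * Ek N (-k) x) * ((s:ℂ) * Ek N (-l) x)
        = ((s * s : ℝ) : ℂ) * Ek N (k - l) x := by
      intro x
      rw [map_mul, ← Ek_neg, neg_neg, sub_eq_add_neg, Ek_add, Complex.conj_ofReal]
      push_cast
      ring
    simp only [this]
    rw [integral_const_mul, Ek_int N hN, hs2]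
    by_cases hkl : k = l
    · have : (N:ℂ) ≠ 0 := by exact_mod_cast hN.ne'
      simp only [hkl, sub_self, if_true]
      push_cast
      field_simp
    · rw [if_neg (by rwa [sub_eq_zero]), if_neg hkl, mul_zero]
  have hB := horth.sum_inner_products_le ((hmem a ha).toLp a) (s := F)
  have hn : ‖(hmem a ha).toLp a‖ ^ 2 = ∫ x in cubeN N, ‖a x‖ ^ 2 := by
    have h1 := inner_self_eq_norm_sq_to_K (𝕜 := ℂ) ((hmem a ha).toLp a)
    rw [hinner _ _ ha ha] at h1
    have h2 : ∀ x, (starRingEnd ℂ) (a x) * a x = ((‖a x‖ ^ 2 : ℝ) : ℂ) := by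
      intro x; rw [mul_comm, Complex.mul_conj, Complex.normSq_eq_norm_sq]
    simp only [h2] at h1
    rw [integral_complex_ofReal] at h1
    have h3 : ((∫ x, ‖a x‖ ^ 2 ∂μ : ℝ) : ℂ) = ((‖(hmem a ha).toLp a‖ ^ 2 : ℝ) : ℂ) := by
      rw [h1]; push_cast; rfl
    exact (Complex.ofReal_injective h3).symm
  rw [hn] at hB
  have hk : ∀ k, ‖inner ℂ ((hmem _ (hEc k)).toLp _) ((hmem a ha).toLp a)‖ ^ 2
      = ((N:ℝ)^3)⁻¹ * ‖fCoeff N a (xiN N k)‖ ^ 2 := by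
    intro k
    rw [hinner _ _ (hEc k) ha]
    have : ∀ x, (starRingEnd ℂ) ((s:ℂ) * Ek N (-k) x) * a x
        = (s : ℂ) * (Ek N k x * a x) := by
      intro x
      rw [map_mul, ← Ek_neg, neg_neg, Complex.conj_ofReal]
      ring
    simp only [this]
    rw [integral_const_mul, norm_mul, mul_pow, ← hs2]
    congr 1
    simp [sq]
  simp only [hk] at hB
  rw [← Finset.mul_sum] at hB
  rwa [inv_mul_le_iff₀ hNp] at hB

lemma h_bound (N : ℕ) (hN : 0 < N) (φ : V3 → ℂ) (hφ : ContDiff ℝ 1 φ) (hp : IsPerN N φ)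
    (k : Fin 3 → ℤ) :
    nsqV (xiN N k) * ‖fCoeffR N (fun x => Complex.normSq (φ x)) (xiN N k)‖ ^ 2
      ≤ 3 * (∫ x in cubeN N, (Complex.normSq (φ x) + gradSq φ x)) ^ 2 := by
  set I := ∫ x in cubeN N, (Complex.normSq (φ x) + gradSq φ x) with hI
  set h : V3 → ℂ := fun x => ((Complex.normSq (φ x) : ℝ) : ℂ) with hh
  have hh' : h = fun x => φ x * Complex.conjCLE (φ x) := by
    ext x; rw [hh]; simp [Complex.mul_conj]
  have hd : ContDiff ℝ 1 h := by
    rw [hh']; exact hφ.mul (Complex.conjCLE.contDiff.comp hφ)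
  have hper : IsPerN N h := fun x m => by simp only [hh, hp x m]
  have hc : Continuous (fun x => fderiv ℝ φ x) := hφ.continuous_fderiv (by norm_num)
  have hc2 : Continuous (fun x => fderiv ℝ h x) := hd.continuous_fderiv (by norm_num)
  have hφc := hφ.continuous
  have hgc : Continuous (fun x => Complex.normSq (φ x) + gradSq φ x) := by
    unfold gradSq
    refine (Complex.continuous_normSq.comp hφc).add (continuous_finsetSum _ fun i _ => ?_)
    exact Complex.continuous_normSq.comp (by fun_prop)
  have hpt : ∀ i x, ‖fderiv ℝ h x (Pi.single i 1)‖ ≤ Complex.normSq (φ x) + gradSq φ x := by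
    intro i x
    have hdx := (hφ.differentiable (by norm_num) x).hasFDerivAt
    have h1 := hdx.mul (Complex.conjCLE.hasFDerivAt.comp x hdx)
    have h2 := h1.fderiv
    have h2e : h = φ * (Complex.conjCLE ∘ φ) := hh'
    have h3 : Complex.normSq (fderiv ℝ φ x (Pi.single i 1)) ≤ gradSq φ x := by
      unfold gradSq
      exact Finset.single_le_sum (f := fun i => Complex.normSq (fderiv ℝ φ x (Pi.single i 1)))
        (fun _ _ => Complex.normSq_nonneg _) (Finset.mem_univ i)
    rw [h2e, h2]
    refine le_trans ?_ (add_le_add_right h3 _)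
    rw [Complex.normSq_eq_norm_sq, Complex.normSq_eq_norm_sq]
    simp only [add_apply, smul_apply, smul_eq_mul, ContinuousLinearMap.comp_apply]
    refine (norm_add_le _ _).trans ?_
    simp
    nlinarith [sq_nonneg (‖φ x‖ - ‖fderiv ℝ φ x (Pi.single i 1)‖)]
  have hi : ∀ i, (xiN N k i) ^ 2 * ‖fCoeff N h (xiN N k)‖ ^ 2 ≤ I ^ 2 := by
    intro i
    have h1 := ibp N hN h hd hper k i
    have h2 : ‖∫ x in cubeN N, Ek N k x * fderiv ℝ h x (Pi.single i 1)‖ ≤ I := by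
      refine norm_integral_le_of_norm_le (intOn N hgc) (Filter.Eventually.of_forall fun x => ?_)
      rw [norm_mul, Ek_norm, one_mul]
      exact hpt i x
    have h3 := congrArg norm h1
    rw [norm_neg] at h3
    rw [← h3, norm_mul, norm_mul, Complex.norm_I, one_mul, Complex.norm_real] at h2
    have := pow_le_pow_left₀ (by positivity) h2 2
    rwa [mul_pow, Real.norm_eq_abs, sq_abs] at this
  change nsqV (xiN N k) * ‖fCoeff N h (xiN N k)‖ ^ 2 ≤ 3 * I ^ 2
  unfold nsqV
  rw [Finset.sum_mul]
  refine (Finset.sum_le_sum fun i _ => hi i).trans ?_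
  simp

lemma nsq_lower (N : ℕ) (k : Fin 3 → ℤ) : (2 * π / N) ^ 2 * ‖k‖ ^ 2 ≤ nsqV (xiN N k) := by
  obtain ⟨i, hi⟩ : ∃ i, ‖k‖ = ‖k i‖ := by
    obtain ⟨i, _, hi⟩ := Finset.exists_mem_eq_sup' (s := Finset.univ) Finset.univ_nonempty (fun i => ‖k i‖)
    refine ⟨i, le_antisymm ?_ (norm_le_pi_norm k i)⟩
    rw [pi_norm_le_iff_of_nonneg (norm_nonneg _)]
    intro j
    rw [← hi]
    exact Finset.le_sup' (fun i => ‖k i‖) (Finset.mem_univ j)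
  rw [hi]
  unfold nsqV
  refine le_trans (le_of_eq ?_) (Finset.single_le_sum (f := fun i => xiN N k i ^ 2)
    (fun _ _ => sq_nonneg _) (Finset.mem_univ i))
  simp only [xiN, mul_pow, Int.norm_eq_abs, sq_abs]

lemma one_le_norm {k : Fin 3 → ℤ} (hk : k ≠ 0) : 1 ≤ ‖k‖ := by
  obtain ⟨i, hi⟩ := Function.ne_iff.1 hk
  refine le_trans ?_ (norm_le_pi_norm k i)
  rw [Int.norm_eq_abs]
  exact_mod_cast Int.one_le_abs hi

lemma summable4 : Summable (fun k : Fin 3 → ℤ => (‖k‖ ^ 4)⁻¹) := by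
  set L : Submodule ℤ V3 := Submodule.span ℤ (Set.range (Pi.basisFun ℝ (Fin 3))) with hL
  have hr : Module.finrank ℤ L = 3 := by
    rw [ZLattice.rank ℝ L]; simp
  have h := ZLattice.summable_norm_pow_inv L 4 (by omega)
  have hm : ∀ k : Fin 3 → ℤ, (fun i => (k i : ℝ)) ∈ L := by
    intro k
    rw [hL, (Pi.basisFun ℝ (Fin 3)).mem_span_iff_repr_mem ℤ]
    intro i
    exact ⟨k i, by simp⟩
  have hinj : Function.Injective (fun k : Fin 3 → ℤ => (⟨fun i => (k i : ℝ), hm k⟩ : L)) := by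
    intro k l hkl
    have := congrArg Subtype.val hkl
    ext i
    have h2 : (k i : ℝ) = (l i : ℝ) := congrFun this i
    exact_mod_cast h2
  refine (h.comp_injective hinj).congr fun k => ?_
  simp only [Function.comp_apply, inv_pow]
  congr 2

lemma key (N : ℕ) (hN : 0 < N) : ∃ K > (0:ℝ), ∀ (e : ℝ) (a : V3 → ℝ) (φ : V3 → ℂ),
    Continuous a → IsPerN N φ → ContDiff ℝ 1 φ → ∀ F : Finset (Fin 3 → ℤ),
    ∑ k ∈ F, (if k = 0 then 0 else
      ‖fCoeffR N (fun x => a x - e * Complex.normSq (φ x)) (xiN N k)‖ ^ 2 / nsqV (xiN N k))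
    ≤ K * ((∫ x in cubeN N, a x ^ 2)
      + e ^ 2 * (∫ x in cubeN N, (Complex.normSq (φ x) + gradSq φ x)) ^ 2) := by
  have hN' : (0:ℝ) < N := by exact_mod_cast hN
  set c : ℝ := (2 * π / N) ^ 2 with hc
  have hcp : 0 < c := by positivity
  set S := ∑' k : Fin 3 → ℤ, (‖k‖ ^ 4)⁻¹ with hS
  have hS0 : 0 ≤ S := tsum_nonneg fun _ => by positivity
  refine ⟨2 / c * (N:ℝ)^3 + 6 / c ^ 2 * S, by positivity, ?_⟩
  intro e a φ ha hp hφ F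
  set I := ∫ x in cubeN N, (Complex.normSq (φ x) + gradSq φ x) with hI
  have hφc := hφ.continuous
  have hnc : Continuous (fun x => Complex.normSq (φ x)) := Complex.continuous_normSq.comp hφc
  have hsplit : ∀ k, fCoeffR N (fun x => a x - e * Complex.normSq (φ x)) (xiN N k)
      = fCoeffR N a (xiN N k) - (e:ℂ) * fCoeffR N (fun x => Complex.normSq (φ x)) (xiN N k) := by
    intro k
    have hEc := (Ek_contDiff N k).continuous
    unfold fCoeffR fCoeff
    change ∫ x in cubeN N, Ek N k x * _ = (∫ x in cubeN N, Ek N k x * _)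
      - (e:ℂ) * (∫ x in cubeN N, Ek N k x * _)
    rw [← integral_const_mul, ← integral_sub (intOn N (by fun_prop)) (intOn N (by fun_prop))]
    congr 1
    ext x
    push_cast
    ring
  have hterm : ∀ k ∈ F, (if k = 0 then 0 else
      ‖fCoeffR N (fun x => a x - e * Complex.normSq (φ x)) (xiN N k)‖ ^ 2 / nsqV (xiN N k))
      ≤ 2 / c * ‖fCoeffR N a (xiN N k)‖ ^ 2 + 6 / c ^ 2 * e ^ 2 * I ^ 2 * (‖k‖ ^ 4)⁻¹ := by
    intro k _
    split_ifs with hk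
    · positivity
    have hk1 := one_le_norm hk
    have hw := nsq_lower N k
    rw [← hc] at hw
    have hh := h_bound N hN φ hφ hp k
    rw [← hI] at hh
    rw [hsplit]
    set w := nsqV (xiN N k)
    set A := fCoeffR N a (xiN N k)
    set H := fCoeffR N (fun x => Complex.normSq (φ x)) (xiN N k)
    have hwc : c ≤ w := le_trans (le_mul_of_one_le_right hcp.le (one_le_pow₀ hk1)) hw
    have hwp : 0 < w := by linarith
    have h1 : ‖A - (e:ℂ) * H‖ ^ 2 ≤ 2 * ‖A‖ ^ 2 + 2 * e ^ 2 * ‖H‖ ^ 2 := by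
      have := norm_sub_le A ((e:ℂ) * H)
      rw [norm_mul, Complex.norm_real, Real.norm_eq_abs] at this
      have h2 := pow_le_pow_left₀ (norm_nonneg _) this 2
      have h3 : (|e| * ‖H‖) ^ 2 = e ^ 2 * ‖H‖ ^ 2 := by rw [mul_pow, sq_abs]
      nlinarith [sq_nonneg (‖A‖ - |e| * ‖H‖)]
    have h2 : 2 * ‖A‖ ^ 2 / w ≤ 2 / c * ‖A‖ ^ 2 := by
      rw [div_mul_eq_mul_div]
      gcongr
    have h3 : ‖H‖ ^ 2 / w ≤ 3 * I ^ 2 / (c ^ 2 * ‖k‖ ^ 4) := by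
      have : ‖H‖ ^ 2 ≤ 3 * I ^ 2 / w := by rw [le_div_iff₀ hwp]; linarith
      calc ‖H‖ ^ 2 / w ≤ (3 * I ^ 2 / w) / w := by gcongr
        _ = 3 * I ^ 2 / w ^ 2 := by field_simp
        _ ≤ 3 * I ^ 2 / (c * ‖k‖ ^ 2) ^ 2 := by gcongr
        _ = _ := by ring
    calc ‖A - (e:ℂ) * H‖ ^ 2 / w ≤ (2 * ‖A‖ ^ 2 + 2 * e ^ 2 * ‖H‖ ^ 2) / w := by gcongr
      _ = 2 * ‖A‖ ^ 2 / w + 2 * e ^ 2 * (‖H‖ ^ 2 / w) := by ring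
      _ ≤ 2 / c * ‖A‖ ^ 2 + 2 * e ^ 2 * (3 * I ^ 2 / (c ^ 2 * ‖k‖ ^ 4)) := by gcongr
      _ = _ := by
        have : ‖k‖ ≠ 0 := by positivity
        field_simp
        ring
  refine (Finset.sum_le_sum hterm).trans ?_
  rw [Finset.sum_add_distrib, ← Finset.mul_sum, ← Finset.mul_sum]
  have hB := bessel N hN (fun x => (a x : ℂ)) (by fun_prop) F
  simp only [Complex.norm_real, Real.norm_eq_abs, sq_abs] at hB
  change ∑ k ∈ F, ‖fCoeffR N a (xiN N k)‖ ^ 2 ≤ _ at hB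
  have hSF : ∑ k ∈ F, (‖k‖ ^ 4)⁻¹ ≤ S := summable4.sum_le_tsum F fun _ _ => by positivity
  have hJ : 0 ≤ ∫ x in cubeN N, a x ^ 2 := integral_nonneg fun _ => sq_nonneg _
  set J := ∫ x in cubeN N, a x ^ 2
  calc _ ≤ 2 / c * ((N:ℝ)^3 * J) + 6 / c ^ 2 * e ^ 2 * I ^ 2 * S := by gcongr
    _ ≤ _ := by
      have h1 : 0 ≤ 2 / c * (N:ℝ)^3 * (e ^ 2 * I ^ 2) := by positivity
      have h2 : 0 ≤ 6 / c ^ 2 * S * J := by positivity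
      linarith

lemma per_bdd {E : Type*} [NormedAddCommGroup E] (N : ℕ) (hN : 0 < N) (g : V3 → E)
    (hg : Continuous g) (hp : IsPerN N g) : ∃ M : ℝ, 0 ≤ M ∧ ∀ x, ‖g x‖ ≤ M := by
  have hN' : (0:ℝ) < N := by exact_mod_cast hN
  obtain ⟨M, hM⟩ := (isCompact_Icc (a := (0 : V3)) (b := fun _ => (N:ℝ))).exists_bound_of_continuousOn
    hg.continuousOn
  have h : ∀ x, ‖g x‖ ≤ M := by
    intro x
    rw [← hp x (fun i => -⌊x i / N⌋)]
    apply hM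
    refine ⟨fun i => ?_, fun i => ?_⟩
    · have := Int.floor_le (x i / N)
      rw [le_div_iff₀ hN'] at this
      simp only [Pi.zero_apply, Pi.add_apply]
      push_cast
      linarith
    · have := Int.lt_floor_add_one (x i / N)
      rw [div_lt_iff₀ hN'] at this
      simp only [Pi.add_apply]
      push_cast
      linarith
  exact ⟨M, (norm_nonneg _).trans (h 0), h⟩

lemma per_fderiv {E : Type*} [NormedAddCommGroup E] [NormedSpace ℝ E] (N : ℕ) (g : V3 → E)
    (hp : IsPerN N g) : IsPerN N (fderiv ℝ g) := by
  intro x k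
  rw [← fderiv_comp_add_right]
  congr 1
  ext y
  exact hp y k

lemma taylor (N : ℕ) (hN : 0 < N) (σ : V3 → ℝ) (hper : IsPerN N σ) (hreg : ContDiff ℝ 2 σ) :
    ∃ M : ℝ, 0 ≤ M ∧ (∀ x, ‖fderiv ℝ σ x‖ ≤ M) ∧
      ∀ x v, |σ (x - v) - σ x + fderiv ℝ σ x v| ≤ M * ‖v‖ ^ 2 := by
  have h1 : ContDiff ℝ 1 (fderiv ℝ σ) := hreg.fderiv_right (by norm_num)
  obtain ⟨M1, hM1, hb1⟩ := per_bdd N hN _ h1.continuous (per_fderiv N σ hper)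
  obtain ⟨M2, hM2, hb2⟩ := per_bdd N hN _ (h1.continuous_fderiv (by norm_num))
    (per_fderiv N _ (per_fderiv N σ hper))
  refine ⟨max M1 M2, le_max_of_le_left hM1, fun x => (hb1 x).trans (le_max_left _ _), ?_⟩
  intro x v
  have hlip : ∀ z, ‖fderiv ℝ σ z - fderiv ℝ σ x‖ ≤ M2 * ‖z - x‖ := fun z =>
    convex_univ.norm_image_sub_le_of_norm_fderiv_le
      (fun y _ => h1.differentiable (by norm_num) y) (fun y _ => hb2 y) trivial trivial
  have h2 := (convex_closedBall x ‖v‖).norm_image_sub_le_of_norm_fderiv_le' (f := σ) (C := M2 * ‖v‖)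
    (φ := fderiv ℝ σ x) (x := x) (y := x - v)
    (fun y _ => hreg.differentiable (by norm_num) y)
    (fun y hy => (hlip y).trans (by
      rw [mem_closedBall_iff_norm] at hy; gcongr)) (by simp) (by simp)
  rw [Real.norm_eq_abs] at h2
  have e1 : x - v - x = -v := by abel
  rw [e1, norm_neg, map_neg, sub_neg_eq_add] at h2
  refine h2.trans ?_
  have : M2 ≤ max M1 M2 := le_max_right _ _
  rw [mul_assoc, ← sq]
  gcongr

lemma dotP_grad (σ : V3 → ℝ) (x v : V3) : dotP v (gradV σ x) = fderiv ℝ σ x v := by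
  unfold dotP gradV
  conv_rhs => rw [pi_eq_sum_univ' v, map_sum]
  simp

/-- cubic bound on the remainder of the Taylor expansion. -/
theorem stmt12 (N : ℕ) (hN : 0 < N) (σ : V3 → ℝ) (e Z : ℝ) (he : 0 < e) (hZ : 0 < Z)
    (hper : IsPerN N σ) (hreg : ContDiff ℝ 2 σ)
    (hint : (∫ x in cubeN N, σ x) = e * Z) :
    ∃ C > (0 : ℝ), ∀ (α : ℝ) (r : V3) (φ : V3 → ℂ) (κ : GammaIdx N → V3),
      IsPerN N φ → ContDiff ℝ 1 φ →
      Real.sqrt (∫ x in cubeN N, (Complex.normSq (φ x) + gradSq φ x))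
          + Real.sqrt (∑ n : GammaIdx N, nsqV (κ n)) ≤ 1 →
      |(1 / 2) * GPair N
          (fun x => 2 * rho1F N σ e Z α r κ φ x + rho2F N σ e r κ φ x)
          (fun x => rho2F N σ e r κ φ x)| ≤
        C * (Real.sqrt (∫ x in cubeN N, (Complex.normSq (φ x) + gradSq φ x))
          + Real.sqrt (∑ n : GammaIdx N, nsqV (κ n))) ^ 3 := by
  have hN' : (0:ℝ) < N := by exact_mod_cast hN
  obtain ⟨K, hK, hkey⟩ := key N hN
  obtain ⟨M, hM, hM1, hM2⟩ := taylor N hN σ hper hreg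
  set D : ℝ := (N:ℝ)^3 * M with hD
  have hD0 : 0 ≤ D := by positivity
  set A1 : ℝ := 18 * D ^ 2 * (N:ℝ)^3 + 32 * e ^ 2 * Z + e ^ 2 with hA1
  have hA1p : 0 < A1 := by positivity
  refine ⟨1 / 2 * (((N:ℝ)^3)⁻¹ * (K * A1)), by positivity, ?_⟩
  intro α r φ κ hφp hφ hy
  set I := ∫ x in cubeN N, (Complex.normSq (φ x) + gradSq φ x) with hI
  set Q := ∑ n : GammaIdx N, nsqV (κ n) with hQ
  set y := Real.sqrt I + Real.sqrt Q with hydef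
  have hy0 : 0 ≤ y := by positivity
  have hgs : ∀ x, 0 ≤ gradSq φ x := fun x => Finset.sum_nonneg fun _ _ => Complex.normSq_nonneg _
  have hI0 : 0 ≤ I := integral_nonneg fun x => add_nonneg (Complex.normSq_nonneg _) (hgs x)
  have hIy : I ≤ y ^ 2 := by
    rw [← Real.sqrt_le_left hy0]
    linarith [Real.sqrt_nonneg Q]
  have hκ : ∀ n, ‖κ n‖ ≤ y := by
    intro n
    rw [pi_norm_le_iff_of_nonneg hy0]
    intro i
    have h1 : κ n i ^ 2 ≤ nsqV (κ n) := Finset.single_le_sum (f := fun i => κ n i ^ 2)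
      (fun _ _ => sq_nonneg _) (Finset.mem_univ i)
    have h2 : nsqV (κ n) ≤ Q := Finset.single_le_sum (f := fun n => nsqV (κ n))
      (fun _ _ => Finset.sum_nonneg fun _ _ => sq_nonneg _) (Finset.mem_univ n)
    have h3 := Real.abs_le_sqrt (h1.trans h2)
    rw [Real.norm_eq_abs]
    linarith [Real.sqrt_nonneg I]
  have hφc := hφ.continuous
  have hσc := hreg.continuous
  have hdc : Continuous (fderiv ℝ σ) := hreg.continuous_fderiv (by norm_num)
  have hnc : Continuous (fun x => Complex.normSq (φ x)) := Complex.continuous_normSq.comp hφc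
  have hgc : Continuous (fun x => gradSq φ x) := by
    have hc : Continuous (fun x => fderiv ℝ φ x) := hφ.continuous_fderiv (by norm_num)
    unfold gradSq
    exact continuous_finsetSum _ fun i _ => Complex.continuous_normSq.comp (by fun_prop)
  have hIn : ∫ x in cubeN N, Complex.normSq (φ x) ≤ y ^ 2 := by
    refine le_trans (integral_mono (intOn N hnc) (intOn N (hnc.add hgc)) fun x => ?_) hIy
    have := hgs x
    simp only [Pi.add_apply]
    linarith
  -- the ionic remainder
  set s2 : V3 → ℝ := fun x => ∑ n : GammaIdx N,
      (σ (x - embG n - r - κ n) - σ (x - embG n - r)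
        + dotP (κ n) (gradV σ (x - embG n - r))) with hs2
  have hs2c : Continuous s2 := by
    simp only [hs2, dotP_grad]
    fun_prop
  have hs1c : Continuous (sigma1F N σ r κ) := by
    unfold sigma1F
    simp only [dotP_grad]
    fun_prop
  have hcard : (Fintype.card (GammaIdx N) : ℝ) = (N:ℝ)^3 := by simp
  have hs2b : ∀ x, |s2 x| ≤ D * y ^ 2 := by
    intro x
    refine (Finset.abs_sum_le_sum_abs _ _).trans ?_
    have : ∀ n ∈ (Finset.univ : Finset (GammaIdx N)), |σ (x - embG n - r - κ n) - σ (x - embG n - r)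
        + dotP (κ n) (gradV σ (x - embG n - r))| ≤ M * y ^ 2 := by
      intro n _
      rw [dotP_grad]
      refine (hM2 _ _).trans ?_
      have := hκ n
      gcongr
    refine (Finset.sum_le_sum this).trans (le_of_eq ?_)
    rw [Finset.sum_const, Finset.card_univ, nsmul_eq_mul, hcard, hD]
    ring
  have hs1b : ∀ x, |sigma1F N σ r κ x| ≤ D * y := by
    intro x
    unfold sigma1F
    rw [abs_neg]
    refine (Finset.abs_sum_le_sum_abs _ _).trans ?_
    have : ∀ n ∈ (Finset.univ : Finset (GammaIdx N)),
        |dotP (κ n) (gradV σ (x - embG n - r))| ≤ M * y := by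
      intro n _
      rw [dotP_grad, ← Real.norm_eq_abs]
      refine (ContinuousLinearMap.le_opNorm _ _).trans ?_
      have := hκ n
      have := hM1 (x - embG n - r)
      gcongr
    refine (Finset.sum_le_sum this).trans (le_of_eq ?_)
    rw [Finset.sum_const, Finset.card_univ, nsmul_eq_mul, hcard, hD]
    ring
  set a : V3 → ℝ := fun x => 2 * rho1F N σ e Z α r κ φ x + s2 x with ha
  have hac : Continuous a := by
    simp only [ha, rho1F]
    have : Continuous fun x => (Complex.exp (-Complex.I * (α : ℂ)) * φ x).re :=
      Complex.continuous_re.comp (by fun_prop)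
    fun_prop
  have hsq : Real.sqrt Z ^ 2 = Z := Real.sq_sqrt hZ.le
  have hab : ∀ x, a x ^ 2 ≤ 18 * D ^ 2 * y ^ 2 + 32 * e ^ 2 * Z * Complex.normSq (φ x) := by
    intro x
    have h1 : |(Complex.exp (-Complex.I * (α : ℂ)) * φ x).re| ≤ ‖φ x‖ := by
      refine (Complex.abs_re_le_norm _).trans (le_of_eq ?_)
      rw [norm_mul, show -Complex.I * (α:ℂ) = ((-α : ℝ) : ℂ) * Complex.I by push_cast; ring,
        Complex.norm_exp_ofReal_mul_I, one_mul]
    have h2 := hs1b x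
    have h3 : |s2 x| ≤ D * y := (hs2b x).trans (by
      have : y ^ 2 ≤ y := by nlinarith
      gcongr)
    have hax : a x = (2 * sigma1F N σ r κ x + s2 x)
        + (- (4 * e * Real.sqrt Z * (Complex.exp (-Complex.I * (α : ℂ)) * φ x).re)) := by
      simp only [ha, rho1F]; ring
    have h4 : (2 * sigma1F N σ r κ x + s2 x) ^ 2 ≤ (3 * D * y) ^ 2 := by
      rw [← sq_abs]
      refine pow_le_pow_left₀ (abs_nonneg _) ?_ 2
      rw [abs_le] at h2 h3 ⊢
      constructor <;> linarith [h2.1, h2.2, h3.1, h3.2]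
    have h5 : (- (4 * e * Real.sqrt Z * (Complex.exp (-Complex.I * (α : ℂ)) * φ x).re)) ^ 2
        ≤ 16 * e ^ 2 * Z * Complex.normSq (φ x) := by
      rw [neg_sq, mul_pow, mul_pow, mul_pow, hsq, Complex.normSq_eq_norm_sq]
      have h6 := pow_le_pow_left₀ (abs_nonneg _) h1 2
      rw [sq_abs] at h6
      have h7 := mul_le_mul_of_nonneg_left h6 (by positivity : 0 ≤ 16 * e ^ 2 * Z)
      linarith
    rw [hax]
    refine (add_sq_le).trans ?_
    nlinarith
  have haJ : ∫ x in cubeN N, a x ^ 2 ≤ (18 * D ^ 2 * (N:ℝ)^3 + 32 * e ^ 2 * Z) * y ^ 2 := by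
    refine (integral_mono (intOn N (hac.pow 2)) (intOn N (f := fun x =>
      18 * D ^ 2 * y ^ 2 + 32 * e ^ 2 * Z * Complex.normSq (φ x)) (by fun_prop)) hab).trans ?_
    rw [integral_add (intOn N (by fun_prop)) (intOn N (by fun_prop)),
      integral_const_mul (32 * e ^ 2 * Z), setIntegral_const, vol_cube, smul_eq_mul]
    have : 32 * e ^ 2 * Z * ∫ x in cubeN N, Complex.normSq (φ x) ≤ 32 * e ^ 2 * Z * y ^ 2 := by
      gcongr
    linarith
  have hsJ : ∫ x in cubeN N, s2 x ^ 2 ≤ D ^ 2 * (N:ℝ)^3 * y ^ 4 := by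
    refine (integral_mono (intOn N (hs2c.pow 2)) (intOn N (f := fun x => (D * y ^ 2) ^ 2)
      (by fun_prop)) fun x => ?_).trans ?_
    · change s2 x ^ 2 ≤ _
      rw [← sq_abs]
      exact pow_le_pow_left₀ (abs_nonneg _) (hs2b x) 2
    · rw [setIntegral_const, vol_cube, smul_eq_mul]
      apply le_of_eq; ring
  have hI2 : I ^ 2 ≤ y ^ 4 := by
    calc I ^ 2 ≤ (y ^ 2) ^ 2 := by gcongr
      _ = y ^ 4 := by ring
  have hy42 : y ^ 4 ≤ y ^ 2 := pow_le_pow_of_le_one hy0 hy (by norm_num)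
  have hf : (fun x => 2 * rho1F N σ e Z α r κ φ x + rho2F N σ e r κ φ x)
      = fun x => a x - e * Complex.normSq (φ x) := by
    ext x; simp only [ha, rho2F, hs2]; ring
  have hg : (fun x => rho2F N σ e r κ φ x) = fun x => s2 x - e * Complex.normSq (φ x) := rfl
  have hHf : ∀ F, _ ≤ K * (A1 * y ^ 2) := fun F => (hkey e a φ hac hφp hφ F).trans (by
    gcongr
    have : e ^ 2 * I ^ 2 ≤ e ^ 2 * y ^ 2 := mul_le_mul_of_nonneg_left (hI2.trans hy42) (sq_nonneg e)
    rw [hA1]; linarith)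
  have hHg : ∀ F, _ ≤ K * (A1 * y ^ 4) := fun F => (hkey e s2 φ hs2c hφp hφ F).trans (by
    gcongr
    have h1 : e ^ 2 * I ^ 2 ≤ e ^ 2 * y ^ 4 := by gcongr
    have h2 : 0 ≤ (17 * D ^ 2 * (N:ℝ)^3 + 32 * e ^ 2 * Z) * y ^ 4 := by positivity
    rw [hA1]; linarith)
  unfold GPair
  rw [hf, hg]
  set fh : (Fin 3 → ℤ) → ℂ :=
    fun k => fCoeffR N (fun x => a x - e * Complex.normSq (φ x)) (xiN N k) with hfh
  set gh : (Fin 3 → ℤ) → ℂ :=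
    fun k => fCoeffR N (fun x => s2 x - e * Complex.normSq (φ x)) (xiN N k) with hgh
  set T : (Fin 3 → ℤ) → ℝ := fun k => if k = 0 then 0 else
    (fh k * (starRingEnd ℂ) (gh k)).re / nsqV (xiN N k) with hT
  have hnn : ∀ k, 0 ≤ nsqV (xiN N k) := fun k => Finset.sum_nonneg fun _ _ => sq_nonneg _
  have hfin : ∀ F : Finset (Fin 3 → ℤ), ∑ k ∈ F, |T k| ≤ K * A1 * y ^ 3 := by
    intro F
    set u : (Fin 3 → ℤ) → ℝ := fun k => if k = 0 then 0 else ‖fh k‖ / Real.sqrt (nsqV (xiN N k))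
    set v : (Fin 3 → ℤ) → ℝ := fun k => if k = 0 then 0 else ‖gh k‖ / Real.sqrt (nsqV (xiN N k))
    have h1 : ∑ k ∈ F, |T k| ≤ ∑ k ∈ F, u k * v k := by
      apply Finset.sum_le_sum
      intro k _
      simp only [hT, u, v]
      split_ifs with hk
      · simp
      · rw [abs_div, abs_of_nonneg (hnn k), div_mul_div_comm, Real.mul_self_sqrt (hnn k)]
        have := hnn k
        gcongr
        refine (Complex.abs_re_le_norm _).trans (le_of_eq ?_)
        rw [norm_mul, Complex.norm_conj]
    have hu : ∑ k ∈ F, u k ^ 2 ≤ K * (A1 * y ^ 2) := by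
      refine le_trans (le_of_eq (Finset.sum_congr rfl fun k _ => ?_)) (hHf F)
      simp only [u]
      split_ifs with hk
      · simp
      · rw [div_pow, Real.sq_sqrt (hnn k)]
    have hv : ∑ k ∈ F, v k ^ 2 ≤ K * (A1 * y ^ 4) := by
      refine le_trans (le_of_eq (Finset.sum_congr rfl fun k _ => ?_)) (hHg F)
      simp only [v]
      split_ifs with hk
      · simp
      · rw [div_pow, Real.sq_sqrt (hnn k)]
    refine h1.trans ?_
    apply le_of_sq_le_sq _ (by positivity)
    refine (Finset.sum_mul_sq_le_sq_mul_sq F u v).trans ?_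
    calc _ ≤ (K * (A1 * y ^ 2)) * (K * (A1 * y ^ 4)) := by
          gcongr
      _ = _ := by ring
  have hsum : Summable (fun k => |T k|) := summable_of_sum_le (fun _ => abs_nonneg _) hfin
  have htot : |∑' k, T k| ≤ K * A1 * y ^ 3 := by
    have h1 := norm_tsum_le_tsum_norm (f := T) hsum
    exact h1.trans (hsum.tsum_le_of_sum_le hfin)
  rw [abs_mul, abs_mul, abs_of_pos (by norm_num : (0:ℝ) < 1 / 2),
    abs_of_pos (by positivity : (0:ℝ) < ((N:ℝ)^3)⁻¹)]
  calc _ ≤ 1 / 2 * (((N:ℝ)^3)⁻¹ * (K * A1 * y ^ 3)) := by gcongr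
    _ = _ := by ring

end SPN
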